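/- arXiv:math/0611684 — 3 statements merged into one kernel-verified Lean document; each statement's English description precedes it below -/
import Mathlib

section
/- Let Z be a real random variable with cumulative distribution function G. For each θ ≥ 0 set X_θ = θ + Z and define the coverage probability C(θ) = P(max(0, X_θ − d(X_θ)) ≤ θ ≤ X_θ + d(X_θ)). Then C(θ) → 1 − α as θ → ∞. -/
open Set Filter MeasureTheory

theorem strictMono_setIntegral_Iic {g : ℝ → ℝ} (hg_pos : ∀ t, 0 < g t) (hg : Integrable g) :
    StrictMono fun y => ∫ t in Iic y, g t := by
  intro a b hab
  have h := intervalIntegral.integral_Iic_sub_Iic (hg.integrableOn (s := Iic a))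
    (hg.integrableOn (s := Iic b))
  have hpos : 0 < ∫ t in a..b, g t :=
    intervalIntegral.intervalIntegral_pos_of_pos hg.intervalIntegrable hg_pos hab
  dsimp only
  linarith

theorem setIntegral_Iic_neg_add_setIntegral_Iic {g : ℝ → ℝ} (hg_symm : ∀ t, g (-t) = g t)
    (hg : Integrable g) (y : ℝ) :
    (∫ t in Iic (-y), g t) + ∫ t in Iic y, g t = ∫ t, g t := by
  have h := integral_comp_neg_Iic (-y) g
  simp only [hg_symm, neg_neg] at h
  rw [h, add_comm, ← compl_Iic]
  exact integral_add_compl measurableSet_Iic hg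

theorem tendsto_setIntegral_Iic_atTop {g : ℝ → ℝ} (hg : Integrable g) :
    Tendsto (fun y => ∫ t in Iic y, g t) atTop (nhds (∫ t, g t)) :=
  (aecover_Iic tendsto_id).integral_tendsto_of_countably_generated hg

theorem map_eq_withDensity_of_cdf {Ω : Type*} [MeasurableSpace Ω] {P : Measure Ω}
    [IsProbabilityMeasure P] {g : ℝ → ℝ} (hg_nonneg : ∀ t, 0 ≤ g t) (hg : Integrable g)
    {Z : Ω → ℝ} (hZ : Measurable Z)
    (hcdf : ∀ y, (P {ω | Z ω ≤ y}).toReal = ∫ t in Iic y, g t) :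
    P.map Z = volume.withDensity fun t => ENNReal.ofReal (g t) := by
  have := Measure.isProbabilityMeasure_map (μ := P) hZ.aemeasurable
  refine Measure.ext_of_Iic _ _ fun a => ?_
  rw [Measure.map_apply hZ measurableSet_Iic, withDensity_apply _ measurableSet_Iic,
    ← ofReal_integral_eq_lintegral_ofReal hg.integrableOn (ae_of_all _ hg_nonneg), ← hcdf,
    ENNReal.ofReal_toReal (measure_ne_top _ _)]
  rfl

/-- Theorem 1(d) of the paper (location case): as `θ → ∞`, the coverage probability of the
credible interval `[max(0, X_θ - d(X_θ)), X_θ + d(X_θ)]`, with `X_θ = θ + Z`,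
tends to `1 - α`. -/
theorem stmt4 {Ω : Type*} [MeasurableSpace Ω]
    (P : Measure Ω) [IsProbabilityMeasure P]
    (α : ℝ) (hα : α ∈ Set.Ioo (0:ℝ) 1)
    (g G Ginv : ℝ → ℝ)
    (hg_pos : ∀ t, 0 < g t)
    (hg_symm : ∀ t, g (-t) = g t)
    (hg_incr : StrictMonoOn g (Iic 0))
    (hg_decr : StrictAntiOn g (Ici 0))
    (hg_int : Integrable g)
    (hg_one : ∫ t, g t = 1)
    (hG : ∀ y, G y = ∫ t in Iic y, g t)
    (hGinv : ∀ p, 0 < p → p < 1 → G (Ginv p) = p)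
    (d₁ d₂ d : ℝ → ℝ)
    (hd₁ : ∀ y, d₁ y = Ginv (1 - α * G y))
    (hd₂ : ∀ y, d₂ y = Ginv (1/2 + ((1 - α)/2) * G y))
    (hd : ∀ y, d y = max (d₁ y) (d₂ y))
    (Z : Ω → ℝ) (hZ : Measurable Z)
    (hZcdf : ∀ y : ℝ, (P {ω | Z ω ≤ y}).toReal = G y) :
    Tendsto (fun θ : ℝ =>
        (P {ω | max 0 (θ + Z ω - d (θ + Z ω)) ≤ θ ∧ θ ≤ θ + Z ω + d (θ + Z ω)}).toReal)
      atTop (nhds (1 - α)) := by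
  obtain ⟨hα0, hα1⟩ := hα
  have hG' : G = fun y => ∫ t in Iic y, g t := funext hG
  have hmono : StrictMono G := hG' ▸ strictMono_setIntegral_Iic hg_pos hg_int
  have hlim : Tendsto G atTop (nhds 1) := by
    rw [hG', ← hg_one]; exact tendsto_setIntegral_Iic_atTop hg_int
  have hneg (y : ℝ) : G (-y) + G y = 1 := by
    rw [hG, hG, ← hg_one]; exact setIntegral_Iic_neg_add_setIntegral_Iic hg_symm hg_int y
  have hpos (y : ℝ) : 0 < G y :=
    (ENNReal.toReal_nonneg.trans_eq (hZcdf (y - 1))).trans_lt (hmono (by linarith))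
  have hlt (y : ℝ) : G y < 1 := by linarith [hneg y, hpos (-y)]
  have hatom (a : ℝ) : P {ω | Z ω = a} = 0 := by
    have hmap := map_eq_withDensity_of_cdf (fun t => (hg_pos t).le) hg_int hZ
      fun y => (hZcdf y).trans (hG y)
    have : (P.map Z) {a} = 0 := by
      rw [hmap]; exact withDensity_absolutelyContinuous _ _ (measure_singleton a)
    rwa [Measure.map_apply hZ (measurableSet_singleton a)] at this
  set c := Ginv (1 - α / 2)
  have hGc : G c = 1 - α / 2 := hGinv _ (by linarith) (by linarith)
  have hc : 0 < c := hmono.lt_iff_lt.1 (by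
    have := hneg 0
    rw [neg_zero] at this
    linarith)
  have hGZ : Measurable fun ω => G |Z ω| := hmono.monotone.measurable.comp hZ.abs
  have hGθ (θ : ℝ) : Measurable fun ω => G (θ + Z ω) :=
    hmono.monotone.measurable.comp (hZ.const_add θ)
  let S : ℝ → Set Ω := fun θ =>
    {ω | G |Z ω| ≤ 1 - α * G (θ + Z ω)} ∪ {ω | G |Z ω| ≤ 1/2 + ((1 - α)/2) * G (θ + Z ω)}
  have hSmeas (θ : ℝ) : MeasurableSet (S θ) :=
    (measurableSet_le hGZ (((hGθ θ).const_mul α).const_sub 1)).union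
      (measurableSet_le hGZ (((hGθ θ).const_mul _).const_add _))
  have hSeq (θ : ℝ) (hθ : 0 ≤ θ) :
      {ω | max 0 (θ + Z ω - d (θ + Z ω)) ≤ θ ∧ θ ≤ θ + Z ω + d (θ + Z ω)} = S θ := by
    ext ω
    have h0 := hpos (θ + Z ω)
    have h1 := hlt (θ + Z ω)
    have e₁ : G (d₁ (θ + Z ω)) = 1 - α * G (θ + Z ω) := by
      rw [hd₁]; exact hGinv _ (by nlinarith) (by nlinarith)
    have e₂ : G (d₂ (θ + Z ω)) = 1/2 + ((1 - α)/2) * G (θ + Z ω) := by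
      rw [hd₂]; exact hGinv _ (by nlinarith) (by nlinarith)
    have habs : ω ∈ S θ ↔ |Z ω| ≤ d (θ + Z ω) := by
      rw [hd, le_max_iff, ← hmono.le_iff_le, ← hmono.le_iff_le (b := d₂ _), e₁, e₂]
      rfl
    rw [habs, abs_le, mem_ofPred_eq, max_le_iff]
    constructor
    · rintro ⟨⟨-, h⟩, h'⟩
      constructor <;> linarith
    · rintro ⟨h, h'⟩
      exact ⟨⟨hθ, by linarith⟩, by linarith⟩
  let A : Set Ω := {ω | G |Z ω| ≤ 1 - α / 2}
  have hA : (P A).toReal = 1 - α := by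
    have hAeq : A =ᵐ[P] ({ω | Z ω ≤ c} \ {ω | Z ω ≤ -c} : Set Ω) := by
      have hne : ∀ᵐ ω ∂P, Z ω ≠ -c := measure_eq_zero_iff_ae_notMem.1 (hatom (-c))
      filter_upwards [hne] with ω hω
      refine propext ?_
      change G |Z ω| ≤ 1 - α / 2 ↔ Z ω ≤ c ∧ ¬ Z ω ≤ -c
      rw [← hGc, hmono.le_iff_le, abs_le, not_le, and_comm]
      exact and_congr_right fun _ => ⟨fun h => lt_of_le_of_ne h hω.symm, le_of_lt⟩
    have hsub : {ω | Z ω ≤ -c} ⊆ {ω | Z ω ≤ c} :=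
      fun ω hω => le_trans (show Z ω ≤ -c from hω) (by linarith)
    rw [measure_congr hAeq, ← measureReal_def, measureReal_sdiff hsub
        (measurableSet_le hZ measurable_const), measureReal_def, measureReal_def, hZcdf, hZcdf]
    linarith [hneg c]
  have hev : ∀ᵐ ω ∂P, ∀ᶠ θ in atTop, ω ∈ S θ ↔ ω ∈ A := by
    have hne₁ : ∀ᵐ ω ∂P, Z ω ≠ c := measure_eq_zero_iff_ae_notMem.1 (hatom c)
    have hne₂ : ∀ᵐ ω ∂P, Z ω ≠ -c := measure_eq_zero_iff_ae_notMem.1 (hatom (-c))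
    filter_upwards [hne₁, hne₂] with ω h₁ h₂
    have hGω : Tendsto (fun θ => G (θ + Z ω)) atTop (nhds 1) :=
      hlim.comp (tendsto_atTop_add_const_right _ _ tendsto_id)
    have l₁ : Tendsto (fun θ => 1 - α * G (θ + Z ω)) atTop (nhds (1 - α * 1)) :=
      (hGω.const_mul α).const_sub 1
    have l₂ : Tendsto (fun θ => 1/2 + ((1 - α)/2) * G (θ + Z ω)) atTop
        (nhds (1/2 + ((1 - α)/2) * 1)) := (hGω.const_mul _).const_add _
    have hne : G |Z ω| ≠ 1 - α / 2 := by
      rw [← hGc]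
      exact fun h => (eq_or_eq_neg_of_abs_eq (hmono.injective h)).elim h₁ h₂
    rcases hne.lt_or_gt with h | h
    · filter_upwards [l₂.eventually_const_lt (u := G |Z ω|) (by linarith)] with θ hθ
      exact iff_of_true (Or.inr hθ.le) h.le
    · filter_upwards [l₁.eventually_lt_const (u := G |Z ω|) (by linarith),
        l₂.eventually_lt_const (u := G |Z ω|) (by linarith)] with θ hθ₁ hθ₂
      exact iff_of_false (fun hS => hS.elim hθ₁.not_ge hθ₂.not_ge) h.not_ge
  have key : Tendsto (fun θ => P (S θ)) atTop (nhds (P A)) :=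
    tendsto_measure_of_ae_tendsto_indicator_of_isFiniteMeasure atTop
      (measurableSet_le hGZ measurable_const) hSmeas hev
  rw [← hA]
  refine ((ENNReal.tendsto_toReal (measure_ne_top P A)).comp key).congr' ?_
  filter_upwards [eventually_ge_atTop 0] with θ hθ
  rw [hSeq θ hθ, Function.comp_apply]
end

section
/- Assume the skewness condition G(−γ₁(1 − z)) ≤ z/2 for every z ∈ (0,1]. Then: (i) necessarily G(0) < 1 (the case G(0) = 1, i.e. g supported in (−∞,0], is incompatible with the condition, since at z = 1 it would give G(0) ≤ 1/2); and (ii) for any probability space (Ω, 𝓕, P), measurable space S, random element X : Ω → S, measurable a₁, a₂ : S → ℝ with a₂ > 0 everywhere, and real τ ≥ 0 such that Z = (τ − a₁(X))/a₂(X) has cumulative distribution function G, the HPD interval [l(X), u(X)] (defined as in Lemma 5: l(X) = 0 and u(X) = a₁(X) + a₂(X)·G⁻¹(1 − α + α·G(−a₁(X)/a₂(X))) when G(0) = 0 or when 0 < G(0) < 1 and a₁(X)/a₂(X) ≤ y₀; and l(X) = a₁(X) − a₂(X)·γ₁(Δ'(X)), u(X) = a₁(X) + a₂(X)·γ₂(Δ'(X))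 with Δ'(X) = (1−α)(1−G(−a₁(X)/a₂(X))) when 0 < G(0) < 1 and a₁(X)/a₂(X) > y₀) satisfies P(l(X) ≤ τ ≤ u(X)) ≥ (1−α)/(1+α), and for τ = 0, P(l(X) ≤ 0 ≤ u(X)) ≥ 1/(1+α). -/
open Set Filter MeasureTheory

/-- The cumulative distribution function of a continuous integrable density is differentiable. -/
theorem hasDerivAt_integral_Iic {g G : ℝ → ℝ} (hc : Continuous g) (hi : Integrable g)
    (hG : ∀ y, G y = ∫ t in Iic y, g t) (x : ℝ) : HasDerivAt G (g x) x := by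
  have h : ∀ y, G y = G 0 + ∫ t in (0 : ℝ)..y, g t := by
    intro y
    rw [← intervalIntegral.integral_Iic_sub_Iic hi.integrableOn hi.integrableOn, hG, hG]
    ring
  rw [funext h]
  exact (hc.integral_hasStrictDerivAt 0 x).hasDerivAt.const_add _

/-- A monotone function increases strictly to the right of a point with nonzero derivative. -/
theorem Monotone.lt_of_hasDerivAt_ne_zero {G : ℝ → ℝ} {c x y : ℝ} (hm : Monotone G)
    (hd : HasDerivAt G c x) (hc : c ≠ 0) (hxy : x < y) : G x < G y := by
  by_contra! h
  refine hc (IsLocalMax.hasDerivAt_eq_zero ?_ hd)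
  filter_upwards [Iio_mem_nhds hxy] with t ht
  exact (hm (le_of_lt ht)).trans h

/-- If `G` takes different values at two points, its derivative is positive somewhere between. -/
theorem exists_pos_of_hasDerivAt_of_lt {g G : ℝ → ℝ} (hd : ∀ x, HasDerivAt G (g x) x) {x y : ℝ}
    (hxy : x < y) (h : G x < G y) : ∃ t ∈ Ioo x y, 0 < g t := by
  obtain ⟨t, ht, hs⟩ := exists_hasDerivAt_eq_slope G g hxy
    (fun t _ => (hd t).continuousAt.continuousWithinAt) (fun t _ => hd t)
  exact ⟨t, ht, hs ▸ div_pos (sub_pos.2 h) (sub_pos.2 hxy)⟩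

/-- A continuous nonzero density that is strictly unimodal on its support is positive at its
mode. -/
theorem pos_at_mode {g : ℝ → ℝ} (hc : Continuous g) (hn : ∀ t, 0 ≤ g t)
    (hincr : StrictMonoOn g (Function.support g ∩ Iic 0))
    (hdecr : StrictAntiOn g (Function.support g ∩ Ici 0))
    (hex : ∃ x, g x ≠ 0) : 0 < g 0 := by
  by_contra! h0
  replace h0 := le_antisymm h0 (hn 0)
  obtain ⟨x, hx⟩ := hex
  have hxp : 0 < g x := lt_of_le_of_ne (hn x) (Ne.symm hx)
  rcases le_total 0 x with h | h
  · obtain ⟨t, ht, e⟩ := intermediate_value_Icc h hc.continuousOn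
      (show g x / 2 ∈ Icc (g 0) (g x) by rw [h0]; constructor <;> linarith)
    have := hdecr.antitoneOn (a := t) (b := x)
      ⟨by rw [Function.mem_support, e]; positivity, ht.1⟩ ⟨hx, h⟩ ht.2
    linarith
  · obtain ⟨t, ht, e⟩ := intermediate_value_Icc' h hc.continuousOn
      (show g x / 2 ∈ Icc (g 0) (g x) by rw [h0]; constructor <;> linarith)
    have := hincr.monotoneOn (a := x) (b := t) ⟨hx, h⟩
      ⟨by rw [Function.mem_support, e]; positivity, ht.2⟩ ht.1
    linarith

theorem StrictMonoOn.lt_of_pos_of_support {g : ℝ → ℝ} (hn : ∀ t, 0 ≤ g t)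
    (hincr : StrictMonoOn g (Function.support g ∩ Iic 0)) {x y : ℝ} (hxy : x < y) (hy : y ≤ 0)
    (hpos : 0 < g y) : g x < g y := by
  rcases (hn x).eq_or_lt with h | h
  · rwa [← h]
  · exact hincr ⟨h.ne', hxy.le.trans hy⟩ ⟨hpos.ne', hy⟩ hxy

theorem StrictAntiOn.lt_of_pos_of_support {g : ℝ → ℝ} (hn : ∀ t, 0 ≤ g t)
    (hdecr : StrictAntiOn g (Function.support g ∩ Ici 0)) {x y : ℝ} (hxy : x < y) (hx : 0 ≤ x)
    (hpos : 0 < g x) : g y < g x := by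
  rcases (hn y).eq_or_lt with h | h
  · rwa [← h]
  · exact hdecr ⟨hpos.ne', hx⟩ ⟨h.ne', hx.trans hxy.le⟩ hxy

theorem StrictMonoOn.monotoneOn_Iic_of_support {g : ℝ → ℝ} (hn : ∀ t, 0 ≤ g t)
    (hsupp : (Function.support g).OrdConnected)
    (hincr : StrictMonoOn g (Function.support g ∩ Iic 0)) (h0 : 0 < g 0) :
    MonotoneOn g (Iic 0) := by
  intro x hx y hy hxy
  rcases (hn x).eq_or_lt with h | h
  · exact h ▸ hn y
  · exact hincr.monotoneOn ⟨h.ne', hx⟩ ⟨hsupp.out h.ne' h0.ne' ⟨hxy, hy⟩, hy⟩ hxy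

theorem StrictAntiOn.antitoneOn_Ici_of_support {g : ℝ → ℝ} (hn : ∀ t, 0 ≤ g t)
    (hsupp : (Function.support g).OrdConnected)
    (hdecr : StrictAntiOn g (Function.support g ∩ Ici 0)) (h0 : 0 < g 0) :
    AntitoneOn g (Ici 0) := by
  intro x hx y hy hxy
  rcases (hn y).eq_or_lt with h | h
  · exact h ▸ hn x
  · exact hdecr.antitoneOn ⟨hsupp.out h0.ne' h.ne' ⟨hx, hxy⟩, hx⟩ ⟨h.ne', hy⟩ hxy

/-- `[-a, b]` is a shortest interval around `0` among those of the same `G`-mass. -/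
def IsShortest (G : ℝ → ℝ) (a b : ℝ) : Prop :=
  0 ≤ a ∧ 0 ≤ b ∧ ∀ a' b' : ℝ, 0 ≤ a' → 0 ≤ b' → G b' - G (-a') = G b - G (-a) → a + b ≤ a' + b'

/-- The derivative at zero of the mass of the shifted interval `[-a + s, b + s]`. -/
theorem hasDerivAt_shifted_mass {g G : ℝ → ℝ} (hd : ∀ x, HasDerivAt G (g x) x) (a b : ℝ) :
    HasDerivAt (fun s => G (b + s) - G (-a + s)) (g b - g (-a)) 0 := by
  have h1 : HasDerivAt (fun s => G (b + s)) (g b) 0 :=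
    HasDerivAt.comp_const_add (f := G) b 0 (by simpa using hd b)
  have h2 : HasDerivAt (fun s => G (-a + s)) (g (-a)) 0 :=
    HasDerivAt.comp_const_add (f := G) (-a) 0 (by simpa using hd (-a))
  exact h1.sub h2

/-- A function with positive derivative at `0` exceeds its value there just to the right. -/
theorem exists_gt_of_hasDerivAt_pos {f : ℝ → ℝ} {c r : ℝ} (hf : HasDerivAt f c 0) (hc : 0 < c)
    (hr : 0 < r) : ∃ s, 0 < s ∧ s < r ∧ f 0 < f s := by
  have h := (hasDerivAt_iff_tendsto_slope.1 hf).eventually (lt_mem_nhds hc)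
  have h' : ∀ᶠ s in nhdsWithin (0 : ℝ) (Ioi 0), 0 < slope f 0 s :=
    h.filter_mono (nhdsWithin_mono _ fun _ hx => ne_of_gt hx)
  obtain ⟨s, hs, hs'⟩ := (h'.and (Ioo_mem_nhdsGT hr)).exists
  refine ⟨s, hs'.1, hs'.2, ?_⟩
  rw [slope_def_field, sub_zero] at hs
  have := (div_pos_iff_of_pos_right hs'.1).1 hs
  linarith

theorem IsShortest.right_le_left {g G : ℝ → ℝ} (hd : ∀ x, HasDerivAt G (g x) x)
    (hm : Monotone G) {a b : ℝ} (h : IsShortest G a b) (ha : 0 < a) : g b ≤ g (-a) := by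
  by_contra! hlt
  obtain ⟨s, hs0, hsa, hs⟩ :=
    exists_gt_of_hasDerivAt_pos (hasDerivAt_shifted_mass hd a b) (sub_pos.2 hlt) ha
  simp only [add_zero] at hs
  have hc : Continuous G := continuous_iff_continuousAt.2 fun x => (hd x).continuousAt
  have hms : G (-a) ≤ G (-a + s) := hm (by linarith)
  obtain ⟨t, ht, e⟩ := intermediate_value_Icc (show b ≤ b + s by linarith) hc.continuousOn
    (show G b - G (-a) + G (-a + s) ∈ Icc (G b) (G (b + s)) by constructor <;> linarith)
  have hne : t ≠ b + s := by rintro rfl; linarith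
  have hlt' := lt_of_le_of_ne ht.2 hne
  have := h.2.2 (a - s) t (by linarith) (h.2.1.trans ht.1)
    (by rw [e, show -(a - s) = -a + s by ring]; ring)
  linarith

theorem IsShortest.left_le_right {g G : ℝ → ℝ} (hd : ∀ x, HasDerivAt G (g x) x)
    (hm : Monotone G) {a b : ℝ} (h : IsShortest G a b) (hb : 0 < b) : g (-a) ≤ g b := by
  by_contra! hlt
  have hneg : HasDerivAt (fun s => G (b + -s) - G (-a + -s)) (g (-a) - g b) 0 := by
    have := HasDerivAt.comp (0 : ℝ) (h₂ := fun s => G (b + s) - G (-a + s))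
      (by simpa using hasDerivAt_shifted_mass hd a b) (hasDerivAt_neg (0 : ℝ))
    rwa [mul_neg_one, neg_sub] at this
  obtain ⟨s, hs0, hsb, hs⟩ := exists_gt_of_hasDerivAt_pos hneg (sub_pos.2 hlt) hb
  simp only [neg_zero, add_zero] at hs
  have hc : Continuous G := continuous_iff_continuousAt.2 fun x => (hd x).continuousAt
  have hms : G (b + -s) ≤ G b := hm (by linarith)
  obtain ⟨t, ht, e⟩ := intermediate_value_Icc (show -a + -s ≤ -a by linarith) hc.continuousOn
    (show G (b + -s) - (G b - G (-a)) ∈ Icc (G (-a + -s)) (G (-a)) by constructor <;> linarith)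
  have hne : t ≠ -a + -s := by rintro rfl; linarith
  have hlt' := lt_of_le_of_ne ht.1 (Ne.symm hne)
  have := h.2.2 (-t) (b + -s) (by linarith [h.1, ht.2]) (by linarith)
    (by rw [neg_neg, e]; ring)
  linarith

/-- For a strictly unimodal density, shortest intervals of larger mass contain those of smaller
mass. -/
theorem IsShortest.le_of_mass_lt {g G : ℝ → ℝ} (hd : ∀ x, HasDerivAt G (g x) x)
    (hm : Monotone G) (hn : ∀ t, 0 ≤ g t)
    (hsupp : (Function.support g).OrdConnected)
    (hincr : StrictMonoOn g (Function.support g ∩ Iic 0))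
    (hdecr : StrictAntiOn g (Function.support g ∩ Ici 0)) (h0 : 0 < g 0)
    {a b a' b' : ℝ} (h : IsShortest G a b) (h' : IsShortest G a' b')
    (hlt : G b - G (-a) < G b' - G (-a')) : a ≤ a' ∧ b ≤ b' := by
  have hmono := hincr.monotoneOn_Iic_of_support hn hsupp h0
  have hanti := hdecr.antitoneOn_Ici_of_support hn hsupp h0
  obtain ⟨ha, hb, -⟩ := id h
  obtain ⟨ha', hb', -⟩ := id h'
  constructor
  · by_contra! hlt'
    have e1 : G (-a) ≤ G (-a') := hm (by linarith)
    have hG : G b < G b' := by linarith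
    have hbb : b < b' := hm.reflect_lt hG
    have h1 := h.right_le_left hd hm (by linarith)
    have h2 := h'.left_le_right hd hm (by linarith)
    have h3 : g (-a) ≤ g (-a') :=
      hmono (mem_Iic.2 (by linarith)) (mem_Iic.2 (by linarith)) (by linarith)
    obtain ⟨t, ht, htp⟩ := exists_pos_of_hasDerivAt_of_lt hd hbb hG
    have h4 : g t ≤ g b := hanti hb (hb.trans ht.1.le) ht.1.le
    have := hdecr.lt_of_pos_of_support hn hbb hb (by linarith)
    linarith
  · by_contra! hlt'
    have e1 : G b' ≤ G b := hm hlt'.le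
    have hG : G (-a') < G (-a) := by linarith
    have haa : -a' < -a := hm.reflect_lt hG
    have h1 := h.left_le_right hd hm (by linarith)
    have h2 := h'.right_le_left hd hm (by linarith)
    have h3 : g b ≤ g b' := hanti hb' hb hlt'.le
    obtain ⟨t, ht, htp⟩ := exists_pos_of_hasDerivAt_of_lt hd haa hG
    have h4 : g t ≤ g (-a) :=
      hmono (mem_Iic.2 (by linarith [ht.2])) (mem_Iic.2 (by linarith)) ht.2.le
    have := hincr.lt_of_pos_of_support hn haa (by linarith) (by linarith)
    linarith

/-- Corollary 2 of the paper: under the right-skewness condition `G(-γ₁(1-z)) ≤ z/2` for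
all `z ∈ (0,1]`, (i) necessarily `G(0) < 1`, and (ii) the HPD interval `[l(X), u(X)]` of
Lemma 5 has coverage at least `(1-α)/(1+α)` for any `τ ≥ 0`, and coverage at least
`1/(1+α)` of the boundary value `τ = 0`. -/
theorem stmt16 {Ω S : Type*} [MeasurableSpace Ω] [MeasurableSpace S]
    (P : Measure Ω) [IsProbabilityMeasure P]
    (α : ℝ) (hα : α ∈ Set.Ioo (0:ℝ) 1)
    (g G Ginv : ℝ → ℝ)
    (hg_cont : Continuous g)
    (hg_nonneg : ∀ t, 0 ≤ g t)
    (hg_supp : (Function.support g).OrdConnected)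
    (hg_incr : StrictMonoOn g (Function.support g ∩ Iic 0))
    (hg_decr : StrictAntiOn g (Function.support g ∩ Ici 0))
    (hg_int : Integrable g)
    (hg_one : ∫ t, g t = 1)
    (hG : ∀ y, G y = ∫ t in Iic y, g t)
    (hGinv : ∀ p : ℝ, 0 < p → p < 1 →
      Ginv p ∈ interior (Function.support g) ∧ G (Ginv p) = p)
    (γ₁ γ₂ : ℝ → ℝ)
    (hγ : ∀ Δ : ℝ, 0 < Δ → Δ < 1 →
      0 ≤ γ₁ Δ ∧ 0 ≤ γ₂ Δ ∧ G (γ₂ Δ) - G (-(γ₁ Δ)) = Δ ∧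
        ∀ a b : ℝ, 0 ≤ a → 0 ≤ b → G b - G (-a) = Δ → γ₁ Δ + γ₂ Δ ≤ a + b)
    (hγ₁0 : γ₁ 0 = 0) (hγ₂0 : γ₂ 0 = 0)
    (U : ℝ → ℝ)
    (hU : ∀ y, U y = -y + γ₁ ((1 - α) * (1 - G (-y))))
    (y₀ : ℝ)
    (hy₀ : 0 < G 0 → G 0 < 1 → -y₀ ∈ interior (Function.support g) ∧ U y₀ = 0)
    (hskew : ∀ z : ℝ, 0 < z → z ≤ 1 → G (-(γ₁ (1 - z))) ≤ z / 2)
    (X : Ω → S) (hX : Measurable X)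
    (a₁ a₂ : S → ℝ) (ha₁ : Measurable a₁) (ha₂ : Measurable a₂)
    (ha₂pos : ∀ s, 0 < a₂ s)
    (τ : ℝ) (hτ : 0 ≤ τ)
    (hZ : ∀ y : ℝ, (P {ω | (τ - a₁ (X ω)) / a₂ (X ω) ≤ y}).toReal = G y)
    (l u : S → ℝ)
    (hl : ∀ s, l s = if G 0 = 0 ∨ (0 < G 0 ∧ G 0 < 1 ∧ a₁ s / a₂ s ≤ y₀) then 0
      else a₁ s - a₂ s * γ₁ ((1 - α) * (1 - G (-(a₁ s / a₂ s)))))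
    (hu : ∀ s, u s = if G 0 = 0 ∨ (0 < G 0 ∧ G 0 < 1 ∧ a₁ s / a₂ s ≤ y₀)
      then a₁ s + a₂ s * Ginv (1 - α + α * G (-(a₁ s / a₂ s)))
      else a₁ s + a₂ s * γ₂ ((1 - α) * (1 - G (-(a₁ s / a₂ s))))) :
    G 0 < 1 ∧
    (1 - α) / (1 + α) ≤ (P {ω | l (X ω) ≤ τ ∧ τ ≤ u (X ω)}).toReal ∧
    (τ = 0 → 1 / (1 + α) ≤ (P {ω | l (X ω) ≤ 0 ∧ (0:ℝ) ≤ u (X ω)}).toReal) := by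
  obtain ⟨hα0, hα1⟩ := hα
  have hd := hasDerivAt_integral_Iic hg_cont hg_int hG
  have hm : Monotone G := monotone_of_deriv_nonneg (fun x => (hd x).differentiableAt)
    fun x => by rw [(hd x).deriv]; exact hg_nonneg x
  have hGle : ∀ y, G y ≤ 1 := fun y => hZ y ▸ measureReal_le_one
  have hGnn : ∀ y, 0 ≤ G y := fun y => hZ y ▸ ENNReal.toReal_nonneg
  have hg0 : 0 < g 0 := by
    refine pos_at_mode hg_cont hg_nonneg hg_incr hg_decr ?_
    by_contra! h
    simp [h] at hg_one
  have hG0 : 0 < G 0 := by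
    refine lt_of_le_of_ne (hGnn 0) fun h => hg0.ne' ?_
    exact IsLocalMin.hasDerivAt_eq_zero (Eventually.of_forall fun y => h ▸ hGnn y) (hd 0)
  have hG1 : G 0 < 1 := by
    have := hskew 1 one_pos le_rfl
    rw [sub_self, hγ₁0, neg_zero] at this
    linarith
  refine ⟨hG1, ?_⟩
  obtain ⟨hyint, hUy⟩ := hy₀ hG0 hG1
  have hgy : g (-y₀) ≠ 0 := interior_subset hyint
  have hp0 : 0 < G (-y₀) := by
    refine lt_of_le_of_ne (hGnn _) fun h => hgy ?_
    exact IsLocalMin.hasDerivAt_eq_zero (Eventually.of_forall fun y => h ▸ hGnn y) (hd _)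
  have hp1 : G (-y₀) < 1 :=
    (hm.lt_of_hasDerivAt_ne_zero (hd _) hgy (lt_add_one _)).trans_le (hGle _)
  set p := G (-y₀) with hp
  have hmass : ∀ q, q < 1 → 0 ≤ q → 0 < (1 - α) * (1 - q) ∧ (1 - α) * (1 - q) < 1 := by
    intro q hq hq0
    constructor
    · exact mul_pos (by linarith) (by linarith)
    · nlinarith
  obtain ⟨hΔ0, hΔ1⟩ := hmass p hp1 hp0.le
  have hshort : ∀ Δ, 0 < Δ → Δ < 1 → IsShortest G (γ₁ Δ) (γ₂ Δ) := by
    intro Δ h0 h1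
    obtain ⟨h2, h3, h4, h5⟩ := hγ Δ h0 h1
    exact ⟨h2, h3, fun a b ha hb e => h5 a b ha hb (e.trans h4)⟩
  have hγmono : ∀ Δ Δ', 0 < Δ → Δ ≤ Δ' → Δ' < 1 → γ₁ Δ ≤ γ₁ Δ' ∧ γ₂ Δ ≤ γ₂ Δ' := by
    intro Δ Δ' h0 hle h1
    rcases hle.eq_or_lt with rfl | hlt
    · exact ⟨le_rfl, le_rfl⟩
    · refine (hshort Δ h0 (by linarith)).le_of_mass_lt hd hm hg_nonneg hg_supp hg_incr hg_decr
        hg0 (hshort Δ' (by linarith) h1) ?_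
      rwa [(hγ Δ h0 (by linarith)).2.2.1, (hγ Δ' (by linarith) h1).2.2.1]
  have hγy : γ₁ ((1 - α) * (1 - p)) = y₀ := by
    have := hU y₀
    linarith
  set B := γ₂ ((1 - α) * (1 - p)) with hB
  have hGB : G B = (1 - α) * (1 - p) + p := by
    have := (hγ _ hΔ0 hΔ1).2.2.1
    rw [hγy] at this
    linarith
  have hpα : p * (1 + α) ≤ α := by
    have := hskew (1 - (1 - α) * (1 - p)) (by linarith) (by linarith)
    rw [sub_sub_cancel, hγy] at this
    linarith
  have hGinv_lt : ∀ r z, 0 < r → r < 1 → Ginv r < z → r < G z := by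
    intro r z h0 h1 hz
    obtain ⟨hi, e⟩ := hGinv r h0 h1
    exact e ▸ hm.lt_of_hasDerivAt_ne_zero (hd _) (interior_subset hi) hz
  have hcond : ∀ s, (G 0 = 0 ∨ (0 < G 0 ∧ G 0 < 1 ∧ a₁ s / a₂ s ≤ y₀)) ↔ a₁ s / a₂ s ≤ y₀ :=
    fun s => ⟨fun h => h.elim (fun h => absurd h hG0.ne') fun h => h.2.2,
      fun h => Or.inr ⟨hG0, hG1, h⟩⟩
  simp only [hcond] at hl hu
  have hZs : ∀ s, τ = a₁ s + a₂ s * ((τ - a₁ s) / a₂ s) := fun s => by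
    rw [mul_div_cancel₀ _ (ha₂pos s).ne']; ring
  have hYZ : ∀ s, -(a₁ s / a₂ s) ≤ (τ - a₁ s) / a₂ s := fun s => by
    rw [← neg_div]
    exact div_le_div_of_nonneg_right (by linarith) (ha₂pos s).le
  have hprob : ∀ (E : Set Ω) (w : ℝ),
      (∀ ω, -y₀ < (τ - a₁ (X ω)) / a₂ (X ω) → (τ - a₁ (X ω)) / a₂ (X ω) ≤ w → ω ∈ E) →
      G w - p ≤ (P E).toReal := by
    intro E w hE
    have hsub : {ω | (τ - a₁ (X ω)) / a₂ (X ω) ≤ w} ⊆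
        E ∪ {ω | (τ - a₁ (X ω)) / a₂ (X ω) ≤ -y₀} := by
      intro ω hω
      rcases le_or_gt ((τ - a₁ (X ω)) / a₂ (X ω)) (-y₀) with h | h
      · exact Or.inr h
      · exact Or.inl (hE ω h hω)
    have h1 := (measureReal_mono (μ := P) hsub).trans (measureReal_union_le _ _)
    simp only [Measure.real, hZ] at h1 ⊢
    linarith
  constructor
  · have hcov := hprob {ω | l (X ω) ≤ τ ∧ τ ≤ u (X ω)} B ?_
    · refine le_trans ?_ hcov
      rw [hGB, div_le_iff₀ (by linarith)]
      nlinarith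
    · intro ω h1 h2
      set s := X ω
      have e := hZs s
      have hyz := hYZ s
      set Z := (τ - a₁ s) / a₂ s
      set q := G (-(a₁ s / a₂ s)) with hq
      have hqZ : q ≤ G Z := hm hyz
      have hZB : G Z ≤ G B := hm h2
      have hGB1 : G B < 1 := by rw [hGB]; nlinarith
      have hq1 : q < 1 := by linarith
      show l s ≤ τ ∧ τ ≤ u s
      rw [hl s, hu s]
      split_ifs with hc
      · refine ⟨hτ, ?_⟩
        have hpq : p ≤ q := hm (by linarith)
        have hr : Z ≤ Ginv (1 - α + α * q) := by
          by_contra! hlt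
          have := hGinv_lt _ _ (by nlinarith) (by nlinarith) hlt
          nlinarith
        have := mul_le_mul_of_nonneg_left hr (ha₂pos s).le
        linarith
      · have hqp : q ≤ p := hm (by linarith)
        have hle : (1 - α) * (1 - p) ≤ (1 - α) * (1 - q) :=
          mul_le_mul_of_nonneg_left (by linarith) (by linarith)
        obtain ⟨h3, h4⟩ := hγmono _ _ hΔ0 hle (hmass q hq1 (hGnn _)).2
        rw [hγy] at h3
        have h5 := mul_le_mul_of_nonneg_left (show -γ₁ ((1 - α) * (1 - q)) ≤ Z by linarith)
          (ha₂pos s).le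
        have h6 := mul_le_mul_of_nonneg_left (show Z ≤ γ₂ ((1 - α) * (1 - q)) by linarith)
          (ha₂pos s).le
        constructor <;> linarith
  · rintro rfl
    have hlim : 1 - p ≤ (P {ω | l (X ω) ≤ 0 ∧ (0 : ℝ) ≤ u (X ω)}).toReal := by
      refine le_of_forall_pos_le_add fun ε hε => ?_
      have hmin0 : 0 < min ε (1 / 2) := lt_min hε (by norm_num)
      have hmin1 : min ε (1 / 2) ≤ 1 / 2 := min_le_right _ _
      have hminε : min ε (1 / 2) ≤ ε := min_le_left _ _
      obtain ⟨-, hw⟩ := hGinv (1 - min ε (1 / 2)) (by linarith) (by linarith)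
      have hcov := hprob {ω | l (X ω) ≤ 0 ∧ (0 : ℝ) ≤ u (X ω)} (Ginv (1 - min ε (1 / 2))) ?_
      · linarith
      · intro ω h1 h2
        set s := X ω
        have e := hZs s
        have hYZ' : -(a₁ s / a₂ s) = (0 - a₁ s) / a₂ s := by rw [zero_sub, neg_div]
        have hc : a₁ s / a₂ s ≤ y₀ := by linarith
        show l s ≤ 0 ∧ 0 ≤ u s
        rw [hl s, hu s, if_pos hc, if_pos hc, hYZ']
        set Z := (0 - a₁ s) / a₂ s
        have hZ1 : G Z < 1 := by linarith [hm h2]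
        have hr : Z ≤ Ginv (1 - α + α * G Z) := by
          by_contra! hlt
          have := hGinv_lt _ _ (by nlinarith [hGnn Z]) (by nlinarith) hlt
          nlinarith
        have := mul_le_mul_of_nonneg_left hr (ha₂pos s).le
        exact ⟨le_rfl, by linarith⟩
    refine le_trans ?_ hlim
    rw [div_le_iff₀ (by linarith)]
    nlinarith
end

section
/- Assume 0 < G(0) < 1 and that g is positive on all of ℝ, and let y₀ be the unique real number with U_{G,α}(y₀) = 0. Let Z be a real random variable such that −Z has cumulative distribution function G. For θ ≥ 0 set X_θ = θ + Z, Δ'(X_θ) = (1−α)(1−G(−X_θ)), and define l(X_θ) = 0, u(X_θ) = X_θ + G⁻¹(1 − α + α·G(−X_θ)) when X_θ ≤ y₀, and l(X_θ) = X_θ − γ₁(Δ'(X_θ)), u(X_θ) = X_θ + γ₂(Δ'(X_θ)) when X_θ > y₀. Then the coverage probability P(l(X_θ) ≤ θ ≤ u(X_θ)) converges to 1 − α as θ → ∞. -/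
open Set Filter MeasureTheory

lemma exists_scale_mass_eq {G : ℝ → ℝ} (hG : Continuous G) {a b Δ : ℝ} (hΔ : 0 ≤ Δ)
    (hab : Δ ≤ G b - G (-a)) :
    ∃ t ∈ Icc (0 : ℝ) 1, G (t * b) - G (-(t * a)) = Δ := by
  have hc : ContinuousOn (fun t : ℝ => G (t * b) - G (-(t * a))) (Icc 0 1) := by
    fun_prop
  exact intermediate_value_Icc zero_le_one hc (by simpa using ⟨hΔ, hab⟩)

lemma shortest_interval_unique {G : ℝ → ℝ} (hG : Continuous G)
    (hconc : StrictConcaveOn ℝ (Ici 0) G) (hconv : StrictConvexOn ℝ (Iic 0) G)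
    {Δ a b a' b' : ℝ} (hΔ : 0 < Δ) (ha : 0 ≤ a) (hb : 0 ≤ b) (ha' : 0 ≤ a') (hb' : 0 ≤ b')
    (hab : G b - G (-a) = Δ) (hab' : G b' - G (-a') = Δ)
    (hmin : ∀ x y : ℝ, 0 ≤ x → 0 ≤ y → G y - G (-x) = Δ → a + b ≤ x + y)
    (hle : a' + b' ≤ a + b) : a' = a ∧ b' = b := by
  have hsum : a' + b' = a + b := le_antisymm hle (hmin a' b' ha' hb' hab')
  by_contra hne
  have hane : a' ≠ a := fun h => hne ⟨h, by linarith⟩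
  have hbne : b' ≠ b := fun h => hane (by linarith)
  have h1 := hconc.2 hb hb' hbne.symm (by norm_num : (0 : ℝ) < 1 / 2)
    (by norm_num : (0 : ℝ) < 1 / 2) (by norm_num)
  have h2 := hconv.2 (show -a ∈ Iic 0 by simpa using ha) (show -a' ∈ Iic 0 by simpa using ha')
    (fun h => hane (neg_injective h).symm) (by norm_num : (0 : ℝ) < 1 / 2)
    (by norm_num : (0 : ℝ) < 1 / 2) (by norm_num)
  simp only [smul_eq_mul] at h1 h2
  rw [show 1 / 2 * -a + 1 / 2 * -a' = -((a + a') / 2) by ring] at h2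
  rw [show 1 / 2 * b + 1 / 2 * b' = (b + b') / 2 by ring] at h1
  have hmass : Δ < G ((b + b') / 2) - G (-((a + a') / 2)) := by linarith
  obtain ⟨t, ⟨ht0, ht1⟩, ht⟩ := exists_scale_mass_eq hG hΔ.le hmass.le
  have htlt : t < 1 := by
    refine lt_of_le_of_ne ht1 ?_
    rintro rfl
    simp only [one_mul] at ht
    linarith
  have hlen := hmin (t * ((a + a') / 2)) (t * ((b + b') / 2)) (by positivity) (by positivity) ht
  have hpos : 0 < a + b := by
    refine lt_of_le_of_ne (add_nonneg ha hb) fun h => ?_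
    have h0a : a = 0 := by linarith
    have h0b : b = 0 := by linarith
    subst h0a h0b
    simp at hab
    linarith
  have : a + b ≤ t * (a + b) := by
    calc a + b ≤ _ := hlen
      _ = t * (((a + b) + (a' + b')) / 2) := by ring
      _ = t * (a + b) := by rw [hsum]; ring
  nlinarith

lemma tendsto_shortest_interval {ι : Type*} {l : Filter ι} {G γ₁ γ₂ : ℝ → ℝ} (hG : Continuous G)
    (hconc : StrictConcaveOn ℝ (Ici 0) G) (hconv : StrictConvexOn ℝ (Iic 0) G)
    (hγ : ∀ Δ : ℝ, 0 < Δ → Δ < 1 →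
      0 ≤ γ₁ Δ ∧ 0 ≤ γ₂ Δ ∧ G (γ₂ Δ) - G (-(γ₁ Δ)) = Δ ∧
        ∀ a b : ℝ, 0 ≤ a → 0 ≤ b → G b - G (-a) = Δ → γ₁ Δ + γ₂ Δ ≤ a + b)
    {D : ℝ} (hD0 : 0 < D) (hD1 : D < 1) {δ : ι → ℝ} (hδ : Tendsto δ l (nhds D))
    (hδ0 : ∀ x, 0 < δ x) (hδD : ∀ x, δ x ≤ D) :
    Tendsto (fun x => (γ₁ (δ x), γ₂ (δ x))) l (nhds (γ₁ D, γ₂ D)) := by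
  obtain ⟨ha, hb, hab, hmin⟩ := hγ D hD0 hD1
  have hspec x := hγ (δ x) (hδ0 x) ((hδD x).trans_lt hD1)
  have hlen x : γ₁ (δ x) + γ₂ (δ x) ≤ γ₁ D + γ₂ D := by
    obtain ⟨t, ⟨ht0, ht1⟩, ht⟩ :=
      exists_scale_mass_eq hG (hδ0 x).le ((hδD x).trans hab.ge)
    have := (hspec x).2.2.2 _ _ (mul_nonneg ht0 ha) (mul_nonneg ht0 hb) ht
    nlinarith
  have hK : IsCompact ((Icc 0 (γ₁ D + γ₂ D) ×ˢ Icc 0 (γ₁ D + γ₂ D)) ∩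
      {p : ℝ × ℝ | p.1 + p.2 ≤ γ₁ D + γ₂ D}) :=
    (isCompact_Icc.prod isCompact_Icc).inter_right
      (isClosed_le (by fun_prop) continuous_const)
  refine hK.tendsto_nhds_of_unique_mapClusterPt (Eventually.of_forall fun x => ?_) ?_
  · have h := hlen x
    obtain ⟨h1, h2, -, -⟩ := hspec x
    refine ⟨⟨⟨h1, ?_⟩, ⟨h2, ?_⟩⟩, h⟩ <;> dsimp only <;> linarith
  · rintro ⟨a', b'⟩ ⟨⟨⟨ha', -⟩, ⟨hb', -⟩⟩, hle⟩ hclus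
    have hF : Continuous (fun p : ℝ × ℝ => G p.2 - G (-p.1)) := by fun_prop
    have hclus' := hclus.continuousAt_comp hF.continuousAt
    have hcomp : ((fun p : ℝ × ℝ => G p.2 - G (-p.1)) ∘ fun x => (γ₁ (δ x), γ₂ (δ x))) = δ :=
      funext fun x => (hspec x).2.2.1
    rw [hcomp] at hclus'
    have hmass : G b' - G (-a') = D := by
      have : (nhds (G b' - G (-a')) ⊓ nhds D).NeBot := hclus'.clusterPt.mono hδ
      exact eq_of_nhds_neBot this
    obtain ⟨h1, h2⟩ :=
      shortest_interval_unique hG hconc hconv hD0 ha hb ha' hb' hab hmass hmin hle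
    exact Prod.ext h1 h2

lemma hasDerivAt_integral_Iic_s17 {g : ℝ → ℝ} (hg : Continuous g) (hint : Integrable g) (y : ℝ) :
    HasDerivAt (fun y => ∫ t in Iic y, g t) (g y) y := by
  have h := (hg.integral_hasStrictDerivAt 0 y).hasDerivAt.add_const (∫ t in Iic 0, g t)
  refine h.congr_of_eventuallyEq (Eventually.of_forall fun x => ?_)
  dsimp only
  rw [← intervalIntegral.integral_Iic_sub_Iic hint.integrableOn hint.integrableOn]
  ring

lemma coverage_bounds {Ω : Type*} [MeasurableSpace Ω] {P : Measure Ω} [IsProbabilityMeasure P]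
    {W : Ω → ℝ} (hW : Measurable W) {G : ℝ → ℝ} (hG : Monotone G)
    (hWG : ∀ y, P.real {ω | W ω ≤ y} = G y) {E : Set Ω} {a b ε c : ℝ} (hε : 0 < ε)
    (hab : -a ≤ b)
    (hE : ∀ ω, W ω ≤ c → ∃ a' b', |a' - a| < ε ∧ |b' - b| < ε ∧
      (ω ∈ E ↔ -a' ≤ W ω ∧ W ω ≤ b')) :
    P.real E ≤ G (b + ε) - G (-a - ε) + (1 - G c) ∧
      G (b - ε) - G (-a + ε) - (1 - G c) ≤ P.real E := by
  have hdiff u v : {ω | W ω ≤ v} \ {ω | W ω ≤ u} = {ω | u < W ω ∧ W ω ≤ v} := by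
    ext ω; simp [and_comm]
  have hIoc u v (huv : u ≤ v) : P.real {ω | u < W ω ∧ W ω ≤ v} = G v - G u := by
    have hsub : {ω | W ω ≤ u} ⊆ {ω | W ω ≤ v} := fun ω (h : W ω ≤ u) => h.trans huv
    rw [← hdiff, measureReal_sdiff hsub (measurableSet_le hW measurable_const), hWG, hWG]
  have htail : P.real {ω | c < W ω} = 1 - G c := by
    rw [← hWG, ← probReal_compl_eq_one_sub (measurableSet_le hW measurable_const)]
    congr 1; ext ω; simp
  constructor
  · rw [← htail, ← hIoc _ _ (by linarith)]
    refine (measureReal_mono ?_).trans (measureReal_union_le _ _)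
    intro ω hω
    rcases lt_or_ge c (W ω) with h | h
    · exact Or.inr h
    · obtain ⟨a', b', h1, h2, h3⟩ := hE ω h
      obtain ⟨h4, h5⟩ := h3.1 hω
      rw [abs_lt] at h1 h2
      exact Or.inl ⟨by linarith, by linarith⟩
  · rw [← htail]
    rcases le_total (-a + ε) (b - ε) with huv | huv
    · rw [← hIoc _ _ huv, sub_le_iff_le_add]
      refine (measureReal_mono ?_).trans (measureReal_union_le _ _)
      rintro ω ⟨h4, h5⟩
      rcases lt_or_ge c (W ω) with h | h
      · exact Or.inr h
      · obtain ⟨a', b', h1, h2, h3⟩ := hE ω h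
        rw [abs_lt] at h1 h2
        exact Or.inl (h3.2 ⟨by linarith, by linarith⟩)
    · have := hG huv
      have h1 : 0 ≤ P.real E := measureReal_nonneg
      have h2 : 0 ≤ P.real {ω | c < W ω} := measureReal_nonneg
      linarith

/-- Theorem 2(d) of the paper (location-model instance): for `0 < G(0) < 1` with `g`
positive on all of `ℝ`, the coverage probability of the HPD interval for a nonnegative
location parameter `θ` observed through `X_θ = θ + Z` (where `-Z` has cdf `G`) tends to
`1 - α` as `θ → ∞`. -/
theorem stmt17 {Ω : Type*} [MeasurableSpace Ω]
    (P : Measure Ω) [IsProbabilityMeasure P]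
    (α : ℝ) (hα : α ∈ Set.Ioo (0:ℝ) 1)
    (g G Ginv : ℝ → ℝ)
    (hg_cont : Continuous g)
    (hg_pos : ∀ t, 0 < g t)
    (hg_incr : StrictMonoOn g (Iic 0))
    (hg_decr : StrictAntiOn g (Ici 0))
    (hg_int : Integrable g)
    (hg_one : ∫ t, g t = 1)
    (hG : ∀ y, G y = ∫ t in Iic y, g t)
    (hGinv : ∀ p : ℝ, 0 < p → p < 1 → G (Ginv p) = p)
    (γ₁ γ₂ : ℝ → ℝ)
    (hγ : ∀ Δ : ℝ, 0 < Δ → Δ < 1 →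
      0 ≤ γ₁ Δ ∧ 0 ≤ γ₂ Δ ∧ G (γ₂ Δ) - G (-(γ₁ Δ)) = Δ ∧
        ∀ a b : ℝ, 0 ≤ a → 0 ≤ b → G b - G (-a) = Δ → γ₁ Δ + γ₂ Δ ≤ a + b)
    (U : ℝ → ℝ)
    (hU : ∀ y, U y = -y + γ₁ ((1 - α) * (1 - G (-y))))
    (hG0pos : 0 < G 0) (hG0lt : G 0 < 1)
    (y₀ : ℝ) (hy₀ : U y₀ = 0)
    (hy₀uniq : ∀ y : ℝ, U y = 0 → y = y₀)
    (Z : Ω → ℝ) (hZmeas : Measurable Z)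
    (hZ : ∀ y : ℝ, (P {ω | -(Z ω) ≤ y}).toReal = G y) :
    Tendsto (fun θ : ℝ =>
      (P {ω |
        (if θ + Z ω ≤ y₀ then (0:ℝ)
          else θ + Z ω - γ₁ ((1 - α) * (1 - G (-(θ + Z ω))))) ≤ θ ∧
        θ ≤ (if θ + Z ω ≤ y₀
          then θ + Z ω + Ginv (1 - α + α * G (-(θ + Z ω)))
          else θ + Z ω + γ₂ ((1 - α) * (1 - G (-(θ + Z ω)))))}).toReal)
      atTop (nhds (1 - α)) := by
  obtain ⟨hα0, hα1⟩ := hα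
  obtain rfl : G = fun y => ∫ t in Iic y, g t := funext hG
  set G : ℝ → ℝ := fun y => ∫ t in Iic y, g t with hGdef
  have hderiv y : HasDerivAt G (g y) y := hasDerivAt_integral_Iic_s17 hg_cont hg_int y
  have hGcont : Continuous G := continuous_iff_continuousAt.2 fun y => (hderiv y).continuousAt
  have hderiv_eq : deriv G = g := funext fun y => (hderiv y).deriv
  have hGmono : StrictMono G := strictMono_of_deriv_pos fun y => by
    rw [hderiv_eq]; exact hg_pos y
  have hconc : StrictConcaveOn ℝ (Ici 0) G :=
    StrictAntiOn.strictConcaveOn_of_deriv (convex_Ici 0) hGcont.continuousOn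
      (by rw [hderiv_eq]; exact hg_decr.mono interior_subset)
  have hconv : StrictConvexOn ℝ (Iic 0) G :=
    StrictMonoOn.strictConvexOn_of_deriv (convex_Iic 0) hGcont.continuousOn
      (by rw [hderiv_eq]; exact hg_incr.mono interior_subset)
  have hWmeas : Measurable fun ω => -Z ω := hZmeas.neg
  have hWG y : P.real {ω | -Z ω ≤ y} = G y := hZ y
  have : IsProbabilityMeasure (P.map fun ω => -Z ω) :=
    Measure.isProbabilityMeasure_map hWmeas.aemeasurable
  have hcdf : (ProbabilityTheory.cdf (P.map fun ω => -Z ω) : ℝ → ℝ) = G := by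
    funext y
    rw [ProbabilityTheory.cdf_eq_real, map_measureReal_apply hWmeas measurableSet_Iic]
    exact hWG y
  have hbot : Tendsto G atBot (nhds 0) := hcdf ▸ ProbabilityTheory.tendsto_cdf_atBot _
  have htop : Tendsto G atTop (nhds 1) := hcdf ▸ ProbabilityTheory.tendsto_cdf_atTop _
  have hG1 y : G y < 1 := (hGmono (lt_add_one y)).trans_le (by rw [← hWG]; exact measureReal_le_one)
  have hG0 y : 0 ≤ G y := by rw [← hWG]; exact measureReal_nonneg
  have hD0 : 0 < 1 - α := by linarith
  have hD1 : 1 - α < 1 := by linarith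
  have hδ : Tendsto (fun x => (1 - α) * (1 - G (-x))) atTop (nhds (1 - α)) := by
    simpa using ((hbot.comp tendsto_neg_atTop_atBot).const_sub 1).const_mul (1 - α)
  have hγlim := tendsto_shortest_interval hGcont hconc hconv hγ hD0 hD1 hδ
    (fun x => mul_pos hD0 (sub_pos.2 (hG1 _)))
    (fun x => mul_le_of_le_one_right hD0.le (by linarith [hG0 (-x)]))
  have hγ₁lim := (continuous_fst.tendsto _).comp hγlim
  have hγ₂lim := (continuous_snd.tendsto _).comp hγlim
  obtain ⟨ha, hb, hab, -⟩ := hγ (1 - α) hD0 hD1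
  set a := γ₁ (1 - α)
  set b := γ₂ (1 - α)
  rw [Metric.tendsto_atTop']
  intro η hη
  have hupper : Tendsto (fun ε => G (b + ε) - G (-a - ε)) (nhds 0) (nhds (1 - α)) := by
    have h : Continuous fun ε => G (b + ε) - G (-a - ε) := by fun_prop
    simpa [hab] using h.tendsto 0
  have hlower : Tendsto (fun ε => G (b - ε) - G (-a + ε)) (nhds 0) (nhds (1 - α)) := by
    have h : Continuous fun ε => G (b - ε) - G (-a + ε) := by fun_prop
    simpa [hab] using h.tendsto 0
  have hnear := ((hupper.eventually_lt_const (by linarith : 1 - α < 1 - α + η / 2)).and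
    (hlower.eventually_const_lt (by linarith : 1 - α - η / 2 < 1 - α))).filter_mono
    (nhdsWithin_le_nhds (s := Ioi 0))
  obtain ⟨ε, ⟨hε1, hε2⟩, hε⟩ := (hnear.and self_mem_nhdsWithin).exists
  obtain ⟨K, hK⟩ := eventually_atTop.1 (((Metric.tendsto_nhds.1 hγ₁lim ε hε).and
    (Metric.tendsto_nhds.1 hγ₂lim ε hε)).and (eventually_gt_atTop y₀))
  have htail : Tendsto (fun θ => G (θ - K)) atTop (nhds 1) :=
    htop.comp (tendsto_atTop_add_const_right _ _ tendsto_id)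
  obtain ⟨N, hN⟩ := eventually_atTop.1
    (htail.eventually_const_lt (by linarith : 1 - η / 2 < 1))
  refine ⟨N, fun θ hθ => ?_⟩
  obtain ⟨hle, hge⟩ := coverage_bounds hWmeas hGmono.monotone hWG hε (by linarith : -a ≤ b)
    (c := θ - K) (E := {ω |
        (if θ + Z ω ≤ y₀ then (0:ℝ)
          else θ + Z ω - γ₁ ((1 - α) * (1 - G (-(θ + Z ω))))) ≤ θ ∧
        θ ≤ (if θ + Z ω ≤ y₀
          then θ + Z ω + Ginv (1 - α + α * G (-(θ + Z ω)))
          else θ + Z ω + γ₂ ((1 - α) * (1 - G (-(θ + Z ω)))))}) (by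
      intro ω hω
      obtain ⟨⟨h1, h2⟩, h3⟩ := hK (θ + Z ω) (by linarith)
      refine ⟨_, _, h1, h2, ?_⟩
      simp only [mem_ofPred_eq, if_neg h3.not_ge, Function.comp_apply]
      constructor <;> rintro ⟨h4, h5⟩ <;> constructor <;> linarith)
  have hNθ := hN θ hθ.le
  rw [Real.dist_eq, abs_lt]
  change _ < P.real _ - _ ∧ P.real _ - _ < _
  constructor <;> linarith
end
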